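/- Let p be a prime number, m a nonnegative integer, N a positive integer, and k̲' ≤ k̲ multi-indices in ℕ^N with k̲'' := k̲ − k̲'. Then the p-adic valuation of the multi-index Berthelot coefficient {k̲ ¦ k̲'} = q_{k̲}!/(q_{k̲'}!·q_{k̲''}!) is at most the p-adic valuation of the product of binomial coefficients ∏_{i=1}^N C(k_i, k'_i); equivalently, the multi-index modified binomial ⟨k̲ ¦ k̲'⟩ := (∏_i C(k_i,k'_i)) · {k̲ ¦ k̲'}^{-1} is a p-adic integer (an element of ℤ_p). -/

import Mathlib

lemma val_fact_step (p : ℕ) [Fact p.Prime] (n : ℕ) :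
    padicValNat p n.factorial = padicValNat p (n / p).factorial + n / p := by
  rw [← padicValNat_mul_div_factorial, padicValNat_factorial_mul]

lemma val_fact_ineq (p : ℕ) [Fact p.Prime] (m a b : ℕ) :
    padicValNat p ((a + b) / p ^ m).factorial + padicValNat p a.factorial
        + padicValNat p b.factorial
      ≤ padicValNat p (a + b).factorial + padicValNat p (a / p ^ m).factorial
        + padicValNat p (b / p ^ m).factorial := by
  induction m with
  | zero => simp
  | succ m ih =>
    have h1 := val_fact_step p ((a + b) / p ^ m)
    have h2 := val_fact_step p (a / p ^ m)
    have h3 := val_fact_step p (b / p ^ m)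
    rw [Nat.div_div_eq_div_mul, ← pow_succ] at h1 h2 h3
    have h4 := Nat.add_div_le_add_div a b (p ^ (m + 1))
    omega

lemma val_prod_fact (p : ℕ) [Fact p.Prime] {N : ℕ} (f : Fin N → ℕ) (hf : ∀ i, f i ≠ 0) :
    padicValNat p (∏ i, f i) = ∑ i, padicValNat p (f i) := by
  classical
  have key : ∀ s : Finset (Fin N), padicValNat p (∏ i ∈ s, f i) = ∑ i ∈ s, padicValNat p (f i) := by
    intro s
    induction s using Finset.induction_on with
    | empty => simp
    | insert a s ha ih =>
      rw [Finset.prod_insert ha, Finset.sum_insert ha,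
        padicValNat.mul (hf a) (Finset.prod_ne_zero_iff.mpr fun i _ => hf i), ih]
  exact key _


open Finset in
/-- multi-index version. For a prime `p`, `m : ℕ`, `N > 0` and multi-indices
`k' ≤ k` in `ℕ^N` with `k'' = k - k'`, the `p`-adic valuation of the multi-index Berthelot
coefficient `{k ¦ k'} = q_{k}! / (q_{k'}! * q_{k''}!)` is at most the `p`-adic valuation of
`∏ i, C(k i, k' i)`; equivalently the multi-index modified binomial `⟨k ¦ k'⟩` is a
`p`-adic integer. -/
theorem berthelot_modified_binomial_padic_int_multiindex (p : ℕ) (hp : p.Prime) (m N : ℕ)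
    (hN : 0 < N) (k k' : Fin N → ℕ) (h : ∀ i, k' i ≤ k i) :
    padicValNat p
        ((∏ i, (k i / p ^ m).factorial) /
          ((∏ i, (k' i / p ^ m).factorial) * (∏ i, ((k i - k' i) / p ^ m).factorial)))
      ≤ padicValNat p (∏ i, (k i).choose (k' i)) := by
  have : Fact p.Prime := ⟨hp⟩
  have hdvd : ((∏ i, (k' i / p ^ m).factorial) * (∏ i, ((k i - k' i) / p ^ m).factorial)) ∣
      ∏ i, (k i / p ^ m).factorial := by
    rw [← Finset.prod_mul_distrib]
    refine Finset.prod_dvd_prod_of_dvd _ _ fun i _ => ?_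
    refine (Nat.factorial_mul_factorial_dvd_factorial_add _ _).trans (Nat.factorial_dvd_factorial ?_)
    have h4 := Nat.add_div_le_add_div (k' i) (k i - k' i) (p ^ m)
    rwa [Nat.add_sub_cancel' (h i)] at h4
  have hc : ∀ i, (k i).choose (k' i) ≠ 0 := fun i => (Nat.choose_pos (h i)).ne'
  have hF : ∀ f : Fin N → ℕ, ∏ i, (f i).factorial ≠ 0 := fun f =>
    Finset.prod_ne_zero_iff.mpr fun i _ => Nat.factorial_ne_zero _
  rw [padicValNat.div_of_dvd hdvd, padicValNat.mul (hF _) (hF _),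
    val_prod_fact p _ fun i => Nat.factorial_ne_zero _,
    val_prod_fact p _ fun i => Nat.factorial_ne_zero _,
    val_prod_fact p _ fun i => Nat.factorial_ne_zero _,
    val_prod_fact p _ hc, Nat.sub_le_iff_le_add, ← Finset.sum_add_distrib,
    ← Finset.sum_add_distrib]
  refine Finset.sum_le_sum fun i _ => ?_
  have h1 := val_fact_ineq p m (k' i) (k i - k' i)
  rw [Nat.add_sub_cancel' (h i)] at h1
  have h2 := congrArg (padicValNat p) (Nat.choose_mul_factorial_mul_factorial (h i))
  rw [padicValNat.mul (mul_ne_zero (hc i) (Nat.factorial_ne_zero _)) (Nat.factorial_ne_zero _),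
    padicValNat.mul (hc i) (Nat.factorial_ne_zero _)] at h2
  omega
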